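/- Let 1 < p < 2 and β ≥ 0 with βq < 1, where q = p/(p−1), and set α = (2/q)(1 − βq). For every γ > 2/q there exists a closed set E ⊆ 𝕋 such that H_h(E) = 0, where h(t) = t^α / (ln(e/t))^γ, and such that every f ∈ A^1_β(𝕋) satisfying Z(f) = E is not cyclic in A^p_β(𝕋). -/

import Mathlib

open MeasureTheory Real Set Filter Topology ENNReal

noncomputable section

instance : Fact (0 < 2 * Real.pi) := ⟨by positivity⟩

/-- The weighted sum `∑ ‖c n‖^p (1+|n|)^{pβ}` of a Fourier-coefficient sequence,
i.e. `‖c‖_{ℓ^p_β}^p`. -/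
def wSum (p β : ℝ) (c : ℤ → ℂ) : ℝ :=
  ∑' n : ℤ, ‖c n‖ ^ p * (1 + |(n : ℝ)|) ^ (p * β)

/-- Membership in `A^p_β(𝕋)` (equivalently `ℓ^p_β(ℤ)`), expressed via the
Fourier coefficient sequence `c`. -/
def MemA (p β : ℝ) (c : ℤ → ℂ) : Prop :=
  Summable fun n : ℤ => ‖c n‖ ^ p * (1 + |(n : ℝ)|) ^ (p * β)

/-- The `A^p_β(𝕋)` (i.e. `ℓ^p_β(ℤ)`) norm of a Fourier-coefficient sequence. -/
def normA (p β : ℝ) (c : ℤ → ℂ) : ℝ := (wSum p β c) ^ (1 / p)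

/-- The function on the circle `𝕋 = ℝ/2πℤ` whose Fourier coefficient sequence is `c`,
namely `t ↦ ∑_{n ∈ ℤ} c_n e^{int}`. -/
def fSum (c : ℤ → ℂ) (t : AddCircle (2 * Real.pi)) : ℂ :=
  ∑' n : ℤ, c n * fourier n t

/-- The zero set `Z(f)` of the function `f` with Fourier coefficients `c`. -/
def zeroSet (c : ℤ → ℂ) : Set (AddCircle (2 * Real.pi)) := {t | fSum c t = 0}

/-- Convolution of coefficient sequences: the Fourier coefficients of the product
of the corresponding functions/distributions. -/
def convSeq (a c : ℤ → ℂ) (n : ℤ) : ℂ := ∑' k : ℤ, a k * c (n - k)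

/-- Cyclicity of (the element with coefficients) `c` in `A^p_β(𝕋)`: there are
trigonometric polynomials `P` (finitely supported coefficient sequences `a`) with
`‖1 - P·f‖_{A^p_β}` arbitrarily small. -/
def IsCyclicA (p β : ℝ) (c : ℤ → ℂ) : Prop :=
  ∀ ε : ℝ, 0 < ε → ∃ a : ℤ → ℂ, (Function.support a).Finite ∧
    normA p β (fun n => (if n = 0 then 1 else 0) - convSeq a c n) < ε

/-- Fourier coefficient `μ̂(n) = ∫ e^{-int} dμ(t)` of a measure on `ℝ/2πℤ`. -/
def muHat (μ : Measure (AddCircle (2 * Real.pi))) (n : ℤ) : ℂ :=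
  ∫ t, fourier (-n) t ∂μ

/-- The `α`-energy `I_α(μ) = ∑_{n ≥ 1} |μ̂(n)|²/(1+n)^{1-α}` of `μ` is finite. -/
def HasFiniteEnergy (α : ℝ) (μ : Measure (AddCircle (2 * Real.pi))) : Prop :=
  Summable fun n : ℕ => ‖muHat μ (n + 1)‖ ^ 2 / (1 + ((n : ℝ) + 1)) ^ (1 - α)

/-- `C_α(E) = 0`: every probability measure supported on a compact subset of `E`
has infinite `α`-energy. -/
def CapacityZero (α : ℝ) (E : Set (AddCircle (2 * Real.pi))) : Prop :=
  ∀ μ : Measure (AddCircle (2 * Real.pi)), IsProbabilityMeasure μ →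
    (∃ K, K ⊆ E ∧ IsCompact K ∧ μ Kᶜ = 0) → ¬ HasFiniteEnergy α μ

/-- `C_α(E) > 0`: some probability measure supported on a compact subset of `E`
has finite `α`-energy. -/
def CapacityPos (α : ℝ) (E : Set (AddCircle (2 * Real.pi))) : Prop :=
  ∃ μ : Measure (AddCircle (2 * Real.pi)), IsProbabilityMeasure μ ∧
    (∃ K, K ⊆ E ∧ IsCompact K ∧ μ Kᶜ = 0) ∧ HasFiniteEnergy α μ

/-- The `k`-fold Minkowski sum `k × E = E + ⋯ + E`. -/
def kFold (k : ℕ) (E : Set (AddCircle (2 * Real.pi))) : Set (AddCircle (2 * Real.pi)) :=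
  {x | ∃ g : Fin k → AddCircle (2 * Real.pi), (∀ i, g i ∈ E) ∧ x = ∑ i, g i}

/-- Smoothness (`C^∞`) of a function on the circle, via its lift to `ℝ`. -/
def SmoothOnCircle (φ : AddCircle (2 * Real.pi) → ℂ) : Prop :=
  ContDiff ℝ (⊤ : ℕ∞) fun x : ℝ => φ (↑x)

/-- `supp S ⊆ E` for the distribution `S` with Fourier coefficients `s`:
`⟨S, φ⟩ = ∑ₙ Ŝ(n) φ̂(−n) = 0` for every `C^∞` function `φ` supported in `𝕋 ∖ E`. -/
def DistSuppIn (s : ℤ → ℂ) (E : Set (AddCircle (2 * Real.pi))) : Prop :=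
  ∀ φ : AddCircle (2 * Real.pi) → ℂ, SmoothOnCircle φ → tsupport φ ⊆ Eᶜ →
    ∑' n : ℤ, s n * fourierCoeff φ (-n) = 0

/-! ### Weighted `ℓ¹` sequences -/

/-- The weight. -/
def wt (β : ℝ) (n : ℤ) : ℝ := (1 + |(n : ℝ)|) ^ β

lemma wt_pos (β : ℝ) (n : ℤ) : 0 < wt β n := by unfold wt; positivity

lemma one_le_wt {β : ℝ} (hβ : 0 ≤ β) (n : ℤ) : 1 ≤ wt β n :=
  Real.one_le_rpow (by linarith [abs_nonneg (n : ℝ)]) hβ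

lemma wt_neg (β : ℝ) (n : ℤ) : wt β (-n) = wt β n := by simp [wt]

lemma wt_zero (β : ℝ) : wt β 0 = 1 := by simp [wt]

lemma wt_add_le {β : ℝ} (hβ : 0 ≤ β) (m n : ℤ) : wt β (m + n) ≤ wt β m * wt β n := by
  unfold wt
  rw [← Real.mul_rpow (by positivity) (by positivity)]
  apply Real.rpow_le_rpow (by positivity) _ hβ
  push_cast
  nlinarith [abs_add_le (m : ℝ) n, abs_nonneg (m : ℝ), abs_nonneg (n : ℝ),
    mul_nonneg (abs_nonneg (m : ℝ)) (abs_nonneg (n : ℝ))]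

/-- Weighted summability. -/
def S1 (β : ℝ) (c : ℤ → ℂ) : Prop := Summable fun n : ℤ => ‖c n‖ * wt β n

lemma memA_one_iff (β : ℝ) (c : ℤ → ℂ) : MemA 1 β c ↔ S1 β c := by
  simp [MemA, S1, wt]

lemma S1.summable_norm {β : ℝ} (hβ : 0 ≤ β) {c : ℤ → ℂ} (h : S1 β c) :
    Summable fun n => ‖c n‖ :=
  Summable.of_nonneg_of_le (fun _ => norm_nonneg _)
    (fun n => le_mul_of_one_le_right (norm_nonneg _) (one_le_wt hβ n)) h

lemma S1.of_finite {β : ℝ} {a : ℤ → ℂ} (h : (Function.support a).Finite) : S1 β a := by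
  apply summable_of_hasFiniteSupport
  apply h.subset
  intro n hn
  simp only [Function.mem_support] at hn ⊢
  intro h0
  simp [h0] at hn

lemma S1.sub {β : ℝ} {a b : ℤ → ℂ} (ha : S1 β a) (hb : S1 β b) :
    S1 β (fun n => a n - b n) := by
  refine Summable.of_nonneg_of_le (fun n => mul_nonneg (norm_nonneg _) (wt_pos _ _).le)
    (fun n => ?_) (Summable.add ha hb)
  rw [← add_mul]
  exact mul_le_mul_of_nonneg_right (norm_sub_le _ _) (wt_pos _ _).le

/-- The unit. -/
def dl (n : ℤ) : ℂ := if n = 0 then 1 else 0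

lemma S1_dl (β : ℝ) : S1 β dl := by
  apply S1.of_finite
  apply (Set.finite_singleton (0 : ℤ)).subset
  intro n hn
  simpa [dl] using hn

/-- shear -/
def shear : ℤ × ℤ ≃ ℤ × ℤ where
  toFun x := (x.2, x.1 - x.2)
  invFun y := (y.1 + y.2, y.1)
  left_inv x := by ext <;> simp
  right_inv y := by ext <;> simp

lemma summable_shear {u v : ℤ → ℝ} (hu : Summable u) (hv : Summable v)
    (hu0 : ∀ n, 0 ≤ u n) (hv0 : ∀ n, 0 ≤ v n) :
    Summable fun x : ℤ × ℤ => u x.2 * v (x.1 - x.2) := by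
  have := Summable.mul_of_nonneg hu hv hu0 hv0
  exact (shear.summable_iff (f := fun x : ℤ × ℤ => u x.1 * v x.2)).2 this

lemma S1.conv {β : ℝ} (hβ : 0 ≤ β) {a b : ℤ → ℂ} (ha : S1 β a) (hb : S1 β b) :
    S1 β (convSeq a b) := by
  have hs := summable_shear ha hb (fun n => mul_nonneg (norm_nonneg _) (wt_pos _ _).le)
    (fun n => mul_nonneg (norm_nonneg _) (wt_pos _ _).le)
  have h0 := summable_shear (ha.summable_norm hβ) (hb.summable_norm hβ)
    (fun n => norm_nonneg _) (fun n => norm_nonneg _)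
  refine Summable.of_nonneg_of_le (fun n => mul_nonneg (norm_nonneg _) (wt_pos _ _).le)
    (fun n => ?_) hs.prod
  have h1 : Summable fun k => ‖a k * b (n - k)‖ := by
    simpa using h0.prod_factor n
  calc ‖convSeq a b n‖ * wt β n ≤ (∑' k, ‖a k * b (n - k)‖) * wt β n :=
        mul_le_mul_of_nonneg_right (norm_tsum_le_tsum_norm h1) (wt_pos _ _).le
    _ = ∑' k, ‖a k * b (n - k)‖ * wt β n := by rw [tsum_mul_right]
    _ ≤ _ := by
      apply Summable.tsum_le_tsum _ (h1.mul_right _) (hs.prod_factor n)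
      intro k
      have := wt_add_le hβ k (n - k)
      rw [add_sub_cancel] at this
      calc ‖a k * b (n - k)‖ * wt β n ≤ ‖a k * b (n - k)‖ * (wt β k * wt β (n - k)) := by gcongr
        _ = _ := by rw [norm_mul]; ring

lemma norm_fourier (n : ℤ) (t : AddCircle (2 * Real.pi)) : ‖fourier n t‖ = 1 := by
  rw [fourier_apply]; exact Circle.norm_coe _

lemma summable_fourier {c : ℤ → ℂ} (h : Summable fun n => ‖c n‖) (t : AddCircle (2 * Real.pi)) :
    Summable fun n => c n * fourier n t := by
  apply Summable.of_norm
  simpa [norm_fourier, -fourier_apply] using h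

lemma fSum_conv {a b : ℤ → ℂ} (ha : Summable fun n => ‖a n‖) (hb : Summable fun n => ‖b n‖)
    (t : AddCircle (2 * Real.pi)) :
    fSum (convSeq a b) t = fSum a t * fSum b t := by
  have h0 := summable_shear ha hb (fun n => norm_nonneg _) (fun n => norm_nonneg _)
  have hF : Summable fun x : ℤ × ℤ => (a x.2 * fourier x.2 t) * (b (x.1 - x.2) * fourier (x.1 - x.2) t) := by
    apply Summable.of_norm
    simpa [norm_fourier, -fourier_apply] using h0
  unfold fSum
  rw [tsum_mul_tsum_of_summable_norm (by simpa [norm_fourier, -fourier_apply] using ha)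
    (by simpa [norm_fourier, -fourier_apply] using hb)]
  rw [← shear.tsum_eq]
  have : ∑' x : ℤ × ℤ, (a (shear x).1 * fourier (shear x).1 t) * (b (shear x).2 * fourier (shear x).2 t)
     = ∑' n, ∑' k, (a k * fourier k t) * (b (n - k) * fourier (n - k) t) :=
    hF.tsum_prod' (fun n => hF.prod_factor n)
  rw [this]
  apply tsum_congr
  intro n
  rw [convSeq, ← tsum_mul_right]
  apply tsum_congr
  intro k
  have : (fourier n t : ℂ) = fourier k t * fourier (n - k) t := by
    rw [← fourier_add, add_sub_cancel]
  rw [this]; ring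

lemma coeff_zero_eq {c : ℤ → ℂ} (h : Summable fun n => ‖c n‖) :
    c 0 = ∫ t, fSum c t ∂(AddCircle.haarAddCircle (T := 2 * Real.pi)) := by
  have key : ∀ n : ℤ, ∫ t, c n * fourier n t ∂(AddCircle.haarAddCircle (T := 2 * Real.pi))
      = if n = 0 then c 0 else 0 := by
    intro n
    rw [integral_const_mul]
    have h2 := congrFun (fourierCoeff_fourier (T := 2 * Real.pi) n) 0
    simp only [fourierCoeff, neg_zero, fourier_zero, one_smul] at h2
    rw [h2]
    by_cases hn : n = 0
    · subst hn; simp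
    · simp [hn, Ne.symm hn]
  unfold fSum
  have := integral_tsum_of_summable_integral_norm (μ := AddCircle.haarAddCircle (T := 2 * Real.pi))
    (F := fun (n : ℤ) t => c n * fourier n t) ?_ ?_
  · rw [← this]
    simp only [key]
    rw [tsum_ite_eq]
  · intro n
    exact (Continuous.integrable_of_hasCompactSupport (by fun_prop)
      (HasCompactSupport.of_compactSpace _))
  · simpa [norm_fourier, -fourier_apply] using h

lemma fSum_continuous {c : ℤ → ℂ} (h : Summable fun n => ‖c n‖) : Continuous (fSum c) := by
  unfold fSum
  refine continuous_tsum (fun n => by fun_prop) h (fun n x => ?_)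
  rw [norm_mul, norm_fourier, mul_one]

lemma fSum_dl (t) : fSum dl t = 1 := by
  unfold fSum dl
  rw [tsum_eq_single 0]
  · simp
  · intro n hn; simp [hn]

lemma convSeq_dl_left (g : ℤ → ℂ) (n : ℤ) : convSeq dl g n = g n := by
  unfold convSeq dl
  rw [tsum_eq_single 0]
  · simp
  · intro n hn; simp [hn]

lemma convSeq_dl_right (g : ℤ → ℂ) (n : ℤ) : convSeq g dl n = g n := by
  unfold convSeq dl
  rw [tsum_eq_single n]
  · simp
  · intro k hk
    have : n - k ≠ 0 := fun h => hk (by omega)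
    simp [this]

lemma summable_conv {a b : ℤ → ℂ} (ha : Summable fun n => ‖a n‖) (hb : Summable fun n => ‖b n‖)
    (n : ℤ) : Summable fun k => a k * b (n - k) := by
  have h0 := summable_shear ha hb (fun n => norm_nonneg _) (fun n => norm_nonneg _)
  apply Summable.of_norm
  simpa using h0.prod_factor n

lemma convSeq_sub_right {a b c : ℤ → ℂ} (ha : Summable fun n => ‖a n‖)
    (hb : Summable fun n => ‖b n‖) (hc : Summable fun n => ‖c n‖) (n : ℤ) :
    convSeq a (fun m => b m - c m) n = convSeq a b n - convSeq a c n := by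
  unfold convSeq
  rw [← (summable_conv ha hb n).tsum_sub (summable_conv ha hc n)]
  simp only [mul_sub]

lemma convSeq_sub_left {a b c : ℤ → ℂ} (ha : Summable fun n => ‖a n‖)
    (hb : Summable fun n => ‖b n‖) (hc : Summable fun n => ‖c n‖) (n : ℤ) :
    convSeq (fun m => a m - b m) c n = convSeq a c n - convSeq b c n := by
  unfold convSeq
  rw [← (summable_conv ha hc n).tsum_sub (summable_conv hb hc n)]
  simp only [sub_mul]

/-! ### The dual norm -/

lemma term_eq (p β : ℝ) (g : ℤ → ℂ) (n : ℤ) :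
    ‖g n‖ ^ p * (1 + |(n : ℝ)|) ^ (p * β) = (‖g n‖ * wt β n) ^ p := by
  unfold wt
  rw [Real.mul_rpow (norm_nonneg _) (by positivity), ← Real.rpow_mul (by positivity), mul_comm p β]

lemma S1.summable_p {p β : ℝ} (hp : 1 ≤ p) {g : ℤ → ℂ} (h : S1 β g) :
    Summable fun n => (‖g n‖ * wt β n) ^ p := by
  have hnn : ∀ n, 0 ≤ ‖g n‖ * wt β n := fun n => mul_nonneg (norm_nonneg _) (wt_pos _ _).le
  refine Summable.of_nonneg_of_le (fun n => Real.rpow_nonneg (hnn n) _) (fun n => ?_)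
    (Summable.mul_left ((∑' n, ‖g n‖ * wt β n) ^ (p - 1)) h)
  have h1 : ‖g n‖ * wt β n ≤ ∑' n, ‖g n‖ * wt β n := h.le_tsum n (fun j _ => hnn j)
  calc (‖g n‖ * wt β n) ^ p = (‖g n‖ * wt β n) ^ (p - 1 + 1) := by ring_nf
    _ = (‖g n‖ * wt β n) ^ (p - 1) * (‖g n‖ * wt β n) := by
      rw [Real.rpow_add_of_nonneg (hnn n) (by linarith) zero_le_one, Real.rpow_one]
    _ ≤ _ := mul_le_mul_of_nonneg_right (Real.rpow_le_rpow (hnn n) h1 (by linarith)) (hnn n)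

lemma wSum_eq (p β : ℝ) (g : ℤ → ℂ) : wSum p β g = ∑' n, (‖g n‖ * wt β n) ^ p := by
  simp only [wSum, term_eq]

lemma wSum_nonneg (p β : ℝ) (g : ℤ → ℂ) : 0 ≤ wSum p β g := by
  rw [wSum_eq]
  exact tsum_nonneg fun n => Real.rpow_nonneg (mul_nonneg (norm_nonneg _) (wt_pos _ _).le) _

lemma normA_nonneg (p β : ℝ) (g : ℤ → ℂ) : 0 ≤ normA p β g :=
  Real.rpow_nonneg (wSum_nonneg _ _ _) _

lemma norm_zero_le_normA {p β : ℝ} (hp : 1 ≤ p) {g : ℤ → ℂ} (h : S1 β g) :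
    ‖g 0‖ ≤ normA p β g := by
  have h1 : (‖g 0‖ * wt β 0) ^ p ≤ wSum p β g := by
    rw [wSum_eq]
    exact (h.summable_p hp).le_tsum 0
      (fun n _ => Real.rpow_nonneg (mul_nonneg (norm_nonneg _) (wt_pos _ _).le) _)
  rw [wt_zero, mul_one] at h1
  calc ‖g 0‖ = (‖g 0‖ ^ p) ^ (1 / p) := by
        rw [← Real.rpow_mul (norm_nonneg _), mul_one_div_cancel (by linarith), Real.rpow_one]
    _ ≤ _ := Real.rpow_le_rpow (Real.rpow_nonneg (norm_nonneg _) _) h1 (by positivity)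

lemma normA_dl {p β : ℝ} (hp : 1 ≤ p) : normA p β dl = 1 := by
  have : wSum p β dl = 1 := by
    rw [wSum_eq, tsum_eq_single 0]
    · simp [dl, wt_zero]
    · intro n hn
      simp [dl, hn, Real.zero_rpow (by linarith : p ≠ 0)]
  simp [normA, this]

lemma S1.shift {β : ℝ} (hβ : 0 ≤ β) {g : ℤ → ℂ} (h : S1 β g) (k : ℤ) :
    S1 β (fun n => g (n - k)) := by
  have h1 : Summable fun n => ‖g (n - k)‖ * wt β (n - k) :=
    ((Equiv.subRight k).summable_iff (f := fun n => ‖g n‖ * wt β n)).2 h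
  refine Summable.of_nonneg_of_le (fun n => mul_nonneg (norm_nonneg _) (wt_pos _ _).le)
    (fun n => ?_) (h1.mul_left (wt β k))
  have := wt_add_le hβ k (n - k)
  rw [add_sub_cancel] at this
  calc ‖g (n - k)‖ * wt β n ≤ ‖g (n - k)‖ * (wt β k * wt β (n - k)) := by gcongr
    _ = _ := by ring

lemma normA_shift {p β : ℝ} (hp : 1 ≤ p) (hβ : 0 ≤ β) {g : ℤ → ℂ} (h : S1 β g) (k : ℤ) :
    normA p β (fun n => g (n - k)) ≤ wt β k * normA p β g := by
  have h1 : wSum p β (fun n => g (n - k)) ≤ (wt β k) ^ p * wSum p β g := by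
    rw [wSum_eq, wSum_eq, ← tsum_mul_left,
      ← (Equiv.subRight k).tsum_eq (fun n => wt β k ^ p * (‖g n‖ * wt β n) ^ p)]
    apply Summable.tsum_le_tsum _ ((h.shift hβ k).summable_p hp)
    · exact ((Equiv.subRight k).summable_iff
        (f := fun n => wt β k ^ p * (‖g n‖ * wt β n) ^ p)).2 ((h.summable_p hp).mul_left _)
    · intro n
      have := wt_add_le hβ k (n - k)
      rw [add_sub_cancel] at this
      have h0 := (wt_pos β n).le
      have h2 := (wt_pos β k).le
      have h3 := (wt_pos β (n - k)).le
      simp only [Equiv.subRight_apply]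
      rw [← Real.mul_rpow h2 (by positivity)]
      apply Real.rpow_le_rpow (by positivity) _ (by linarith)
      calc ‖g (n - k)‖ * wt β n ≤ ‖g (n - k)‖ * (wt β k * wt β (n - k)) := by gcongr
        _ = _ := by ring
  unfold normA
  calc _ ≤ ((wt β k) ^ p * wSum p β g) ^ (1 / p) :=
        Real.rpow_le_rpow (wSum_nonneg _ _ _) h1 (by positivity)
    _ = _ := by
      rw [Real.mul_rpow (Real.rpow_nonneg (wt_pos _ _).le _) (wSum_nonneg _ _ _),
        ← Real.rpow_mul (wt_pos _ _).le, mul_one_div_cancel (by linarith), Real.rpow_one]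

/-- `b` defines a functional of norm at most `C`. -/
def Bd (p β : ℝ) (b : ℤ → ℂ) (C : ℝ) : Prop :=
  ∀ g, S1 β g → ‖convSeq b g 0‖ ≤ C * normA p β g

/-- The weighted l1 norm. -/
def nrm (β : ℝ) (c : ℤ → ℂ) : ℝ := ∑' n : ℤ, ‖c n‖ * wt β n

lemma nrm_nonneg (β : ℝ) (c : ℤ → ℂ) : 0 ≤ nrm β c :=
  tsum_nonneg fun n => mul_nonneg (norm_nonneg _) (wt_pos _ _).le

lemma convSeq_assoc_zero {a b g : ℤ → ℂ} (ha : Summable fun n => ‖a n‖)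
    (hb : Summable fun n => ‖b n‖) (hg : Summable fun n => ‖g n‖) :
    convSeq (convSeq a b) g 0 = ∑' k, a k * convSeq b (fun n => g (n - k)) 0 := by
  have h0 := summable_shear ha hb (fun n => norm_nonneg _) (fun n => norm_nonneg _)
  have hF : Summable fun x : ℤ × ℤ => a x.2 * b (x.1 - x.2) * g (0 - x.1) := by
    refine Summable.of_norm_bounded (h0.mul_right (∑' n, ‖g n‖)) (fun x => ?_)
    rw [norm_mul, norm_mul]
    gcongr
    exact hg.le_tsum _ (fun j _ => norm_nonneg _)
  have e1 : convSeq (convSeq a b) g 0 = ∑' n, ∑' k, a k * b (n - k) * g (0 - n) := by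
    rw [convSeq]
    apply tsum_congr
    intro n
    rw [convSeq, tsum_mul_right]
  rw [e1, ← hF.tsum_comm]
  apply tsum_congr
  intro k
  rw [convSeq, ← tsum_mul_left,
    ← (Equiv.subRight k).tsum_eq (fun n => a k * (b n * g (0 - n - k)))]
  apply tsum_congr
  intro n
  simp only [Equiv.subRight_apply]
  rw [show (0 : ℤ) - (n - k) - k = 0 - n by ring]
  ring

lemma Bd.conv {p β C : ℝ} (hp : 1 ≤ p) (hβ : 0 ≤ β) (hC : 0 ≤ C) {a b : ℤ → ℂ} (ha : S1 β a)
    (hb : S1 β b) (h : Bd p β b C) : Bd p β (convSeq a b) (C * nrm β a) := by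
  intro g hg
  rw [convSeq_assoc_zero (ha.summable_norm hβ) (hb.summable_norm hβ) (hg.summable_norm hβ)]
  have hle : ∀ k, ‖a k * convSeq b (fun n => g (n - k)) 0‖ ≤
      C * (‖a k‖ * wt β k) * normA p β g := by
    intro k
    rw [norm_mul]
    calc ‖a k‖ * ‖convSeq b (fun n => g (n - k)) 0‖
        ≤ ‖a k‖ * (C * (wt β k * normA p β g)) := by
          gcongr
          exact (h _ (hg.shift hβ k)).trans
            (mul_le_mul_of_nonneg_left (normA_shift hp hβ hg k) hC)
      _ = _ := by ring
  have hs : Summable fun k => C * (‖a k‖ * wt β k) * normA p β g :=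
    (Summable.mul_left C ha).mul_right _
  refine (tsum_of_norm_bounded hs.hasSum hle).trans ?_
  rw [tsum_mul_right, tsum_mul_left, nrm]

lemma Bd.of_lq {p q β C : ℝ} (hpq : p.HolderConjugate q) (hC : 0 ≤ C) {b : ℤ → ℂ}
    (hs : Summable fun n => (‖b n‖ / wt β n) ^ q) (hle : ∑' n, (‖b n‖ / wt β n) ^ q ≤ C ^ q) :
    Bd p β b C := by
  intro g hg
  have hp1 : 1 ≤ p := hpq.lt.le
  have hgs := hg.summable_p hp1
  have hgs' : Summable fun n => (‖g (-n)‖ * wt β n) ^ p := by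
    have := ((Equiv.neg ℤ).summable_iff (f := fun n => (‖g n‖ * wt β n) ^ p)).2 hgs
    refine this.congr fun n => ?_
    simp [wt_neg]
  have hgt : ∑' n, (‖g (-n)‖ * wt β n) ^ p = wSum p β g := by
    rw [wSum_eq, ← (Equiv.neg ℤ).tsum_eq]
    simp [wt_neg]
  have H := Real.summable_and_inner_le_Lp_mul_Lq_tsum_of_nonneg hpq
    (f := fun n => ‖g (-n)‖ * wt β n) (g := fun n => ‖b n‖ / wt β n)
    (fun n => mul_nonneg (norm_nonneg _) (wt_pos _ _).le)
    (fun n => div_nonneg (norm_nonneg _) (wt_pos _ _).le) hgs' hs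
  rw [hgt] at H
  unfold convSeq
  have := tsum_of_norm_bounded (f := fun k => b k * g (0 - k)) H.1.hasSum (fun n => by
    rw [norm_mul, zero_sub]
    apply le_of_eq
    have := (wt_pos β n).ne'
    field_simp)
  refine this.trans (H.2.trans ?_)
  rw [mul_comm]
  refine mul_le_mul_of_nonneg_right ?_ (normA_nonneg _ _ _)
  calc (∑' n, (‖b n‖ / wt β n) ^ q) ^ (1 / q) ≤ (C ^ q) ^ (1 / q) :=
        Real.rpow_le_rpow (tsum_nonneg fun n => Real.rpow_nonneg
          (div_nonneg (norm_nonneg _) (wt_pos _ _).le) _) hle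
          (by have := hpq.symm.pos; positivity)
    _ = C := by
      rw [← Real.rpow_mul hC, mul_one_div_cancel hpq.symm.ne_zero, Real.rpow_one]

/-! ### Triangle functions -/

lemma hasSum_Q_nonneg {y : ℝ} (h0 : 0 ≤ y) (h1 : y ≤ 2 * π) :
    HasSum (fun n : ℤ => 1 / (n : ℂ) ^ 2 * fourier n (y : AddCircle (2 * π)))
      ((y ^ 2 / 2 - π * y + π ^ 2 / 3 : ℝ) : ℂ) := by
  have hpi := Real.pi_pos
  have hx : y / (2 * π) ∈ Icc (0 : ℝ) 1 :=
    ⟨by positivity, by rw [div_le_one (by positivity)]; exact h1⟩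
  have H := hasSum_one_div_pow_mul_fourier_mul_bernoulliFun (k := 2) le_rfl hx
  have hpc : (π : ℂ) ≠ 0 := by exact_mod_cast hpi.ne'
  convert! H using 1
  · ext n
    rw [fourier_coe_apply, fourier_coe_apply]
    congr 2
    push_cast
    field_simp
  · rw [bernoulliFun_two]
    push_cast
    have : (2 * (π : ℂ) * Complex.I) ^ 2 = - (4 * π ^ 2) := by
      rw [mul_pow, Complex.I_sq]; ring
    rw [this]
    simp [Nat.factorial]
    field_simp
    ring

lemma hasSum_Q {y : ℝ} (h1 : |y| ≤ 2 * π) :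
    HasSum (fun n : ℤ => 1 / (n : ℂ) ^ 2 * fourier n (y : AddCircle (2 * π)))
      ((y ^ 2 / 2 - π * |y| + π ^ 2 / 3 : ℝ) : ℂ) := by
  rcases le_total 0 y with h | h
  · rw [abs_of_nonneg h] at *
    exact hasSum_Q_nonneg h h1
  · have H := hasSum_Q_nonneg (abs_nonneg y) h1
    rw [sq_abs] at H
    rw [← (Equiv.neg ℤ).hasSum_iff] at H
    convert! H using 1
    ext n
    rw [abs_of_nonpos h]
    simp only [Function.comp, Equiv.neg_apply]
    rw [fourier_coe_apply, fourier_coe_apply]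
    push_cast
    rw [neg_sq]
    congr 2
    ring

/-- Fourier coefficients of the triangle function with half-width `a`. -/
def tri (a : ℝ) (n : ℤ) : ℝ := if n = 0 then 1 else 2 * (1 - Real.cos (n * a)) / (n * a) ^ 2

lemma fSum_tri {a r : ℝ} (ha : 0 < a) (ha' : a ≤ π) (hr : |r| ≤ π) :
    fSum (fun n => (tri a n : ℂ)) (r : AddCircle (2 * π)) =
      ((2 * π / a ^ 2 * ((|r + a| + |r - a|) / 2 - |r|) : ℝ) : ℂ) := by
  have hpi := Real.pi_pos
  have e1 := hasSum_Q (y := r) (by linarith)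
  have e2 := hasSum_Q (y := r + a) (by
    have := abs_add_le r a; rw [abs_of_pos ha] at this; linarith)
  have e3 := hasSum_Q (y := r - a) (by
    have := abs_sub r a; rw [abs_of_pos ha] at this; linarith)
  have e0 : HasSum (fun n : ℤ => if n = 0 then (1 : ℂ) else 0) 1 := hasSum_ite_eq 0 1
  have H := e0.add ((((e1.sub (e2.mul_left (1 / 2))).sub (e3.mul_left (1 / 2)))).mul_left
    (((2 / a ^ 2 : ℝ) : ℂ)))
  have hac : (a : ℂ) ≠ 0 := by exact_mod_cast ha.ne'
  have hpc : (π : ℂ) ≠ 0 := by exact_mod_cast hpi.ne'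
  unfold fSum
  refine HasSum.tsum_eq ?_
  convert! H using 1
  · ext n
    by_cases hn : n = 0
    · subst hn; simp [tri]
    · have hnc : (n : ℂ) ≠ 0 := by exact_mod_cast hn
      simp only [tri, hn, if_false, zero_add]
      simp only [fourier_coe_apply]
      have f1 : ∀ x : ℂ, 2 * (π : ℂ) * Complex.I * n * x / ((2 * π : ℝ) : ℂ) = n * x * Complex.I := by
        intro x; push_cast; field_simp
      simp only [f1]
      push_cast
      rw [show (n : ℂ) * (r + a) * Complex.I = n * r * Complex.I + n * a * Complex.I by ring,
        show (n : ℂ) * (r - a) * Complex.I = n * r * Complex.I + -(n * a) * Complex.I by ring,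
        Complex.exp_add, Complex.exp_add, Complex.cos]
      field_simp
      ring
  · push_cast
    field_simp
    ring

lemma tri_nonneg (a : ℝ) (n : ℤ) : 0 ≤ tri a n := by
  unfold tri
  split_ifs
  · exact zero_le_one
  · have := Real.cos_le_one (n * a)
    have : 0 ≤ 1 - Real.cos (n * a) := by linarith
    positivity

lemma tri_le_one {a : ℝ} (ha : 0 < a) (n : ℤ) : tri a n ≤ 1 := by
  unfold tri
  split_ifs with h
  · exact le_rfl
  · have h1 := Real.one_sub_sq_div_two_le_cos (x := n * a)
    have : (n : ℝ) ≠ 0 := by exact_mod_cast h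
    rw [div_le_one (by positivity)]
    linarith

lemma tri_le_inv {N : ℕ} (hN : 0 < N) {n : ℤ} (h : n ≠ 0) :
    tri (2 * π / N) n ≤ N ^ 2 / (n : ℝ) ^ 2 := by
  unfold tri
  rw [if_neg h]
  have h1 := Real.neg_one_le_cos (n * (2 * π / N))
  have hn : (n : ℝ) ≠ 0 := by exact_mod_cast h
  have hn2 : 0 < (n : ℝ) ^ 2 := by positivity
  have hN' : (0 : ℝ) < N := by exact_mod_cast hN
  have hpi := Real.pi_gt_three
  rw [div_le_div_iff₀ (by positivity) (by positivity)]
  have : (N : ℝ) ^ 2 * (n * (2 * π / N)) ^ 2 = 4 * π ^ 2 * n ^ 2 := by field_simp; ring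
  rw [this]
  have : 2 * (1 - Real.cos (n * (2 * π / N))) ≤ 4 := by linarith
  have : 4 ≤ 4 * π ^ 2 := by nlinarith
  exact mul_le_mul_of_nonneg_right (by linarith) hn2.le

lemma tri_dvd {N : ℕ} (hN : 0 < N) {n : ℤ} (h : n ≠ 0) (hd : (N : ℤ) ∣ n) :
    tri (2 * π / N) n = 0 := by
  unfold tri
  rw [if_neg h]
  obtain ⟨k, rfl⟩ := hd
  have hN' : (N : ℝ) ≠ 0 := by positivity
  have : (((N : ℤ) * k : ℤ) : ℝ) * (2 * π / N) = k * (2 * π) := by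
    push_cast; field_simp
  rw [this, Real.cos_int_mul_two_pi]
  simp

lemma exists_rep (y : AddCircle (2 * π)) : ∃ r : ℝ, (r : AddCircle (2 * π)) = y ∧ |r| ≤ π ∧
    ‖y‖ = |r| := by
  have hpi := Real.pi_pos
  obtain ⟨r, hr, rfl⟩ : ∃ r ∈ Ioc (-π) (-π + 2 * π), (r : AddCircle (2 * π)) = y :=
    ⟨(AddCircle.equivIoc (2 * π) (-π) y : ℝ), (AddCircle.equivIoc (2 * π) (-π) y).2,
      AddCircle.coe_equivIoc⟩
  have hr' : |r| ≤ π := abs_le.2 ⟨hr.1.le, by linarith [hr.2]⟩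
  refine ⟨r, rfl, hr', ?_⟩
  rw [AddCircle.norm_coe_eq_abs_iff _ (by positivity), abs_of_pos (show 0 < 2 * π by positivity)]
  linarith

lemma fSum_tri_nonneg {a : ℝ} (ha : 0 < a) (ha' : a ≤ π) (y : AddCircle (2 * π)) :
    ∃ x : ℝ, 0 ≤ x ∧ fSum (fun n => (tri a n : ℂ)) y = x := by
  obtain ⟨r, rfl, hr, -⟩ := exists_rep y
  refine ⟨_, ?_, fSum_tri ha ha' hr⟩
  have : |r| ≤ (|r + a| + |r - a|) / 2 := by
    have := abs_add_le (r + a) (r - a)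
    rw [show r + a + (r - a) = 2 * r by ring, abs_mul, abs_two] at this
    linarith
  have hpi := Real.pi_pos
  exact mul_nonneg (by positivity) (by linarith)

lemma fSum_tri_eq_zero {a : ℝ} (ha : 0 < a) (ha' : a ≤ π) (y : AddCircle (2 * π)) (hy : a ≤ ‖y‖) :
    fSum (fun n => (tri a n : ℂ)) y = 0 := by
  obtain ⟨r, rfl, hr, h2⟩ := exists_rep y
  rw [fSum_tri ha ha' hr]
  rw [h2] at hy
  have : (|r + a| + |r - a|) / 2 - |r| = 0 := by
    rcases abs_cases r with h | h <;> rcases abs_cases (r + a) with h' | h' <;>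
      rcases abs_cases (r - a) with h'' | h'' <;> linarith
  simp [this]

/-! ### Moment estimates for random sums -/

lemma sum_exp_le {G : Type*} [Fintype G] [Nonempty G] (φ : G → ℝ) (h0 : ∑ x, φ x = 0)
    (h1 : ∀ x, |φ x| ≤ 1) {s : ℝ} (hs : |s| ≤ 1) (M : ℕ) :
    ∑ x : Fin M → G, Real.exp (s * ∑ j, φ (x j)) ≤
      (Fintype.card G : ℝ) ^ M * Real.exp (M * s ^ 2) := by
  classical
  have e1 : ∑ x : Fin M → G, Real.exp (s * ∑ j, φ (x j)) = (∑ g, Real.exp (s * φ g)) ^ M := by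
    rw [Finset.sum_pow', Fintype.piFinset_univ]
    apply Finset.sum_congr rfl
    intro x _
    rw [Finset.mul_sum, Real.exp_sum]
  have e2 : ∑ g, Real.exp (s * φ g) ≤ (Fintype.card G : ℝ) * Real.exp (s ^ 2) := by
    calc ∑ g, Real.exp (s * φ g) ≤ ∑ g, (1 + s * φ g + s ^ 2) := by
          apply Finset.sum_le_sum
          intro g _
          have hb : |s * φ g| ≤ 1 := by
            rw [abs_mul]; exact mul_le_one₀ hs (abs_nonneg _) (h1 g)
          have := Real.abs_exp_sub_one_sub_id_le hb
          have h3 := (abs_le.1 this).2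
          have : (s * φ g) ^ 2 ≤ s ^ 2 := by
            rw [mul_pow]
            have : φ g ^ 2 ≤ 1 := by rw [← sq_abs]; exact pow_le_one₀ (abs_nonneg _) (h1 g)
            nlinarith [sq_nonneg s]
          linarith
      _ = (Fintype.card G : ℝ) * (1 + s ^ 2) := by
          simp only [Finset.sum_add_distrib, ← Finset.mul_sum, h0]
          simp; ring
      _ ≤ _ := by
          gcongr
          linarith [Real.add_one_le_exp (s ^ 2)]
  rw [e1]
  calc _ ≤ ((Fintype.card G : ℝ) * Real.exp (s ^ 2)) ^ M := by
        gcongr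
    _ = _ := by rw [mul_pow, ← Real.exp_nat_mul]

lemma rpow_le_exp {q u : ℝ} (hq : 0 < q) (hu : 0 ≤ u) : u ^ q ≤ q ^ q * Real.exp u := by
  have h1 : u ≤ q * Real.exp (u / q) := by
    have := Real.add_one_le_exp (u / q)
    calc u = q * (u / q) := by field_simp
      _ ≤ _ := by gcongr; linarith
  calc u ^ q ≤ (q * Real.exp (u / q)) ^ q := Real.rpow_le_rpow hu h1 hq.le
    _ = q ^ q * Real.exp u := by
      rw [Real.mul_rpow hq.le (Real.exp_pos _).le, ← Real.exp_mul]
      congr 2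
      field_simp

lemma moment_bound {G : Type*} [Fintype G] [Nonempty G] (χ : G → ℂ) (h0 : ∑ x, χ x = 0)
    (h1 : ∀ x, ‖χ x‖ = 1) {q : ℝ} (hq : 0 < q) {M : ℕ} (hM : 4 ≤ M) :
    ∑ x : Fin M → G, ‖(M : ℂ)⁻¹ * ∑ j, χ (x j)‖ ^ q ≤
      (Fintype.card G : ℝ) ^ M * (2 * Real.exp 4 * q ^ q * (M : ℝ) ^ (-(q / 2))) := by
  have hM0 : (0 : ℝ) < M := by exact_mod_cast (by omega : 0 < M)
  set s : ℝ := 2 / √M with hs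
  have hsq : 0 < √(M : ℝ) := Real.sqrt_pos.2 hM0
  have hs0 : 0 < s := by positivity
  have hs1 : |s| ≤ 1 := by
    rw [abs_of_pos hs0, hs, div_le_one hsq]
    rw [show (2 : ℝ) = √4 by rw [show (4 : ℝ) = 2 ^ 2 by norm_num]; simp]
    exact Real.sqrt_le_sqrt (by exact_mod_cast hM)
  have hs2 : M * s ^ 2 = 4 := by
    rw [hs, div_pow, Real.sq_sqrt hM0.le]; field_simp; norm_num
  have hre0 : ∑ x, (χ x).re = 0 := by rw [← Complex.re_sum, h0]; simp
  have him0 : ∑ x, (χ x).im = 0 := by rw [← Complex.im_sum, h0]; simp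
  have hre1 : ∀ x, |(χ x).re| ≤ 1 := fun x => (Complex.abs_re_le_norm _).trans (h1 x).le
  have him1 : ∀ x, |(χ x).im| ≤ 1 := fun x => (Complex.abs_im_le_norm _).trans (h1 x).le
  have B1 := sum_exp_le _ hre0 hre1 hs1 M
  have B2 := sum_exp_le _ hre0 hre1 (s := -s) (by rwa [abs_neg]) M
  have B3 := sum_exp_le _ him0 him1 hs1 M
  have B4 := sum_exp_le _ him0 him1 (s := -s) (by rwa [abs_neg]) M
  rw [neg_sq] at B2 B4
  rw [hs2] at B1 B2 B3 B4
  have pt : ∀ x : Fin M → G, ‖(M : ℂ)⁻¹ * ∑ j, χ (x j)‖ ^ q ≤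
      (M : ℝ) ^ (-(q / 2)) * q ^ q * ((1 / 2) *
       (Real.exp (s * ∑ j, (χ (x j)).re) + Real.exp (-s * ∑ j, (χ (x j)).re)
        + Real.exp (s * ∑ j, (χ (x j)).im) + Real.exp (-s * ∑ j, (χ (x j)).im))) := by
    intro x
    set Z := ∑ j, χ (x j) with hZ
    rw [← Complex.re_sum, ← Complex.im_sum, ← hZ]
    have hu : ‖(M : ℂ)⁻¹ * Z‖ = (√M)⁻¹ * (‖Z‖ / √M) := by
      rw [norm_mul, norm_inv, Complex.norm_natCast]
      conv_lhs => rw [← Real.mul_self_sqrt hM0.le]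
      rw [mul_inv]; ring
    rw [hu, Real.mul_rpow (by positivity) (by positivity)]
    have hk : ((√(M : ℝ))⁻¹) ^ q = (M : ℝ) ^ (-(q / 2)) := by
      rw [Real.sqrt_eq_rpow, ← Real.rpow_neg hM0.le, ← Real.rpow_mul hM0.le]
      congr 1; ring
    rw [hk, mul_assoc]
    refine mul_le_mul_of_nonneg_left ?_ (by positivity)
    refine (rpow_le_exp hq (by positivity)).trans ?_
    refine mul_le_mul_of_nonneg_left ?_ (by positivity)
    have hn := Complex.norm_le_abs_re_add_abs_im Z
    have hle : ‖Z‖ / √M ≤ (s * |Z.re|) / 2 + (s * |Z.im|) / 2 := by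
      rw [hs]
      calc ‖Z‖ / √M ≤ (|Z.re| + |Z.im|) / √M := by gcongr
        _ = _ := by ring
    have hab : ∀ a b : ℝ, Real.exp (a / 2 + b / 2) ≤ 1 / 2 * (Real.exp a + Real.exp b) := by
      intro a b
      have e1 : Real.exp a = Real.exp (a / 2) ^ 2 := by rw [← Real.exp_nat_mul]; congr 1; push_cast; ring
      have e2 : Real.exp b = Real.exp (b / 2) ^ 2 := by rw [← Real.exp_nat_mul]; congr 1; push_cast; ring
      rw [Real.exp_add, e1, e2]
      nlinarith [sq_nonneg (Real.exp (a / 2) - Real.exp (b / 2))]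
    have habs : ∀ a : ℝ, Real.exp (s * |a|) ≤ Real.exp (s * a) + Real.exp (-s * a) := by
      intro a
      rcases abs_cases a with h | h
      · rw [h.1]; linarith [Real.exp_pos (-s * a)]
      · rw [h.1, show s * -a = -s * a by ring]; linarith [Real.exp_pos (s * a)]
    have := (Real.exp_le_exp.2 hle).trans (hab _ _)
    have h3 := habs Z.re
    have h4 := habs Z.im
    linarith
  refine (Finset.sum_le_sum fun x _ => pt x).trans ?_
  rw [← Finset.mul_sum, ← Finset.mul_sum]
  simp only [Finset.sum_add_distrib]
  set R := (Fintype.card G : ℝ) ^ M * Real.exp 4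
  calc _ ≤ (M : ℝ) ^ (-(q / 2)) * q ^ q * ((1 / 2) * (R + R + R + R)) := by gcongr
    _ = _ := by ring

/-! ### Sum estimates -/

lemma rpow_step {s : ℝ} (hs0 : 0 ≤ s) (hs1 : s < 1) (K : ℕ) :
    ((K + 1 : ℕ) : ℝ) ^ (-s) ≤ (((K + 1 : ℕ) : ℝ) ^ (1 - s) - (K : ℝ) ^ (1 - s)) / (1 - s) := by
  set x : ℝ := ((K + 1 : ℕ) : ℝ) with hx
  have hx1 : 1 ≤ x := by rw [hx]; exact_mod_cast Nat.le_add_left 1 K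
  have hx0 : 0 < x := by linarith
  have hK : (K : ℝ) = x * (1 + -(1 / x)) := by
    rw [hx]; push_cast; field_simp; ring
  have h1 : -1 ≤ -(1 / x) := by
    rw [neg_le_neg_iff, div_le_one hx0]; exact hx1
  have hB := rpow_one_add_le_one_add_mul_self h1 (p := 1 - s) (by linarith) (by linarith)
  rw [hK, Real.mul_rpow hx0.le (by linarith), le_div_iff₀ (by linarith)]
  have e : x ^ (-s) = x ^ (1 - s) * (1 / x) := by
    rw [show -s = (1 - s) - 1 by ring, Real.rpow_sub_one hx0.ne']; ring
  rw [e]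
  have := Real.rpow_nonneg hx0.le (1 - s)
  nlinarith

/-- majorant -/
def uu (s : ℝ) (N : ℕ) (m : ℕ) : ℝ :=
  if m = 0 then 0 else if m ≤ N then (m : ℝ) ^ (-s) else (N : ℝ) ^ (2 - s) / (m : ℝ) ^ 2

lemma uu_nonneg (s : ℝ) (N m : ℕ) : 0 ≤ uu s N m := by
  unfold uu; split_ifs <;> positivity

lemma sum_uu_le {s : ℝ} (hs0 : 0 ≤ s) (hs1 : s < 1) {N : ℕ} (hN : 0 < N) (K : ℕ) :
    ∑ m ∈ Finset.range K, uu s N m ≤ (1 / (1 - s) + 1) * (N : ℝ) ^ (1 - s) := by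
  have hN0 : (0 : ℝ) < N := by exact_mod_cast hN
  have h1 : ∀ K ≤ N, ∑ m ∈ Finset.range (K + 1), uu s N m ≤ (K : ℝ) ^ (1 - s) / (1 - s) := by
    intro K
    induction K with
    | zero =>
      intro _
      simp [uu, Real.zero_rpow (by linarith : 1 - s ≠ 0)]
    | succ K ih =>
      intro hK
      rw [Finset.sum_range_succ]
      have h := ih (by omega)
      have h2 := rpow_step hs0 hs1 K
      have h3 : uu s N (K + 1) = ((K + 1 : ℕ) : ℝ) ^ (-s) := by
        simp [uu, hK]
      rw [h3]
      rw [sub_div] at h2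
      linarith
  have h2 : ∀ j : ℕ, ∑ m ∈ Finset.range (N + j + 1), uu s N m ≤
      (N : ℝ) ^ (1 - s) / (1 - s) + (N : ℝ) ^ (2 - s) * (1 / N - 1 / ((N + j : ℕ) : ℝ)) := by
    intro j
    induction j with
    | zero => simpa using h1 N le_rfl
    | succ j ih =>
      rw [show N + (j + 1) + 1 = (N + j + 1) + 1 by ring, Finset.sum_range_succ]
      have h3 : uu s N (N + j + 1) = (N : ℝ) ^ (2 - s) / ((N + j + 1 : ℕ) : ℝ) ^ 2 := by
        simp [uu, show ¬ (N + j + 1 ≤ N) by omega]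
      rw [h3]
      set y : ℝ := ((N + j : ℕ) : ℝ) with hy
      have hy0 : 0 < y := by rw [hy]; exact_mod_cast (by omega : 0 < N + j)
      have hy1 : ((N + j + 1 : ℕ) : ℝ) = y + 1 := by rw [hy]; push_cast; ring
      rw [show N + (j + 1) = N + j + 1 by ring, hy1]
      have h4 : 1 / (y + 1) ^ 2 ≤ 1 / y - 1 / (y + 1) := by
        rw [div_sub_div _ _ hy0.ne' (by positivity), div_le_div_iff₀ (by positivity) (by positivity)]
        nlinarith
      have h5 := mul_le_mul_of_nonneg_left h4 (Real.rpow_nonneg hN0.le (2 - s))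
      rw [mul_one_div] at h5
      linarith
  have h3 := h2 K
  have h4 : ∑ m ∈ Finset.range K, uu s N m ≤ ∑ m ∈ Finset.range (N + K + 1), uu s N m :=
    Finset.sum_le_sum_of_subset_of_nonneg (Finset.range_mono (by omega))
      (fun _ _ _ => uu_nonneg _ _ _)
  have h5 : (N : ℝ) ^ (2 - s) * (1 / N - 1 / ((N + K : ℕ) : ℝ)) ≤ (N : ℝ) ^ (1 - s) := by
    have e : (N : ℝ) ^ (1 - s) = (N : ℝ) ^ (2 - s) * (1 / N) := by
      rw [show 1 - s = (2 - s) - 1 by ring, Real.rpow_sub_one hN0.ne']; ring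
    rw [e]
    apply mul_le_mul_of_nonneg_left _ (by positivity)
    have : 0 ≤ 1 / ((N + K : ℕ) : ℝ) := by positivity
    linarith
  calc _ ≤ _ := h4
    _ ≤ _ := h3
    _ ≤ (N : ℝ) ^ (1 - s) / (1 - s) + (N : ℝ) ^ (1 - s) := by linarith
    _ = _ := by ring

/-- weighted triangle coefficients -/
def vv (s : ℝ) (N : ℕ) (n : ℤ) : ℝ :=
  if n = 0 then 0 else tri (2 * π / N) n * (1 + |(n : ℝ)|) ^ (-s)

lemma vv_nonneg (s : ℝ) (N : ℕ) (n : ℤ) : 0 ≤ vv s N n := by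
  unfold vv
  split_ifs
  · exact le_rfl
  · exact mul_nonneg (tri_nonneg _ _) (by positivity)

lemma vv_le_uu {s : ℝ} (hs0 : 0 ≤ s) {N : ℕ} (hN : 0 < N) (n : ℤ) :
    vv s N n ≤ uu s N n.natAbs := by
  have hN0 : (0 : ℝ) < N := by exact_mod_cast hN
  have hpi := Real.pi_pos
  unfold vv uu
  by_cases hn : n = 0
  · simp [hn]
  rw [if_neg hn, if_neg (by omega)]
  have habs : ((n.natAbs : ℕ) : ℝ) = |(n : ℝ)| := by
    rw [Nat.cast_natAbs, Int.cast_abs]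
  have hn0 : (n : ℝ) ≠ 0 := by exact_mod_cast hn
  have hp : 0 < |(n : ℝ)| := abs_pos.2 hn0
  split_ifs with h
  · rw [habs]
    calc _ ≤ 1 * (1 + |(n : ℝ)|) ^ (-s) := by
          gcongr; exact tri_le_one (by positivity) n
      _ ≤ _ := by
          rw [one_mul]
          exact Real.rpow_le_rpow_of_nonpos hp (by linarith) (by linarith)
  · have hlt : (N : ℝ) ≤ 1 + |(n : ℝ)| := by
      rw [← habs]
      have : (N : ℝ) ≤ n.natAbs := by exact_mod_cast (by omega : N ≤ n.natAbs)
      linarith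
    rw [habs, sq_abs]
    calc _ ≤ (N ^ 2 / (n : ℝ) ^ 2) * (N : ℝ) ^ (-s) := by
          have h1 := tri_le_inv hN hn
          have h2 := Real.rpow_le_rpow_of_nonpos hN0 hlt (by linarith : -s ≤ 0)
          exact mul_le_mul h1 h2 (by positivity) (by positivity)
      _ = _ := by
          rw [show 2 - s = 2 + -s by ring, Real.rpow_add hN0, Real.rpow_two]; ring

lemma vv_sum {s : ℝ} (hs0 : 0 ≤ s) (hs1 : s < 1) {N : ℕ} (hN : 0 < N) :
    Summable (vv s N) ∧ ∑' n, vv s N n ≤ 2 * (1 / (1 - s) + 1) * (N : ℝ) ^ (1 - s) := by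
  have hU := summable_of_sum_range_le (uu_nonneg s N) (sum_uu_le hs0 hs1 hN)
  have hT := Real.tsum_le_of_sum_range_le (uu_nonneg s N) (sum_uu_le hs0 hs1 hN)
  have hU' : Summable fun m => uu s N (m + 1) := (summable_nat_add_iff 1).2 hU
  have hT' : ∑' m, uu s N (m + 1) ≤ ∑' m, uu s N m := by
    rw [hU.tsum_eq_zero_add]
    linarith [uu_nonneg s N 0]
  have H : HasSum (fun n : ℤ => uu s N n.natAbs) (∑' m, uu s N m + ∑' m, uu s N (m + 1)) := by
    apply HasSum.of_nat_of_neg_add_one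
    · simpa using hU.hasSum
    · convert hU'.hasSum using 3
      omega
  have hv : Summable (vv s N) :=
    Summable.of_nonneg_of_le (vv_nonneg s N) (vv_le_uu hs0 hN) H.summable
  refine ⟨hv, ?_⟩
  calc _ ≤ ∑' n : ℤ, uu s N n.natAbs := hv.tsum_le_tsum (vv_le_uu hs0 hN) H.summable
    _ = _ := H.tsum_eq
    _ ≤ _ := by linarith

/-! ### The random building block -/

/-- The grid point. -/
def gp (N : ℕ) (g : Fin N) : AddCircle (2 * π) := (((g : ℕ) : ℝ) * (2 * π / N) : ℝ)

/-- Characters on the grid. -/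
def ch (N : ℕ) (n : ℤ) (g : Fin N) : ℂ := fourier (-n) (gp N g)

lemma ch_norm (N : ℕ) (n : ℤ) (g : Fin N) : ‖ch N n g‖ = 1 := norm_fourier _ _

lemma ch_sum {N : ℕ} (hN : 0 < N) {n : ℤ} (hn : ¬ (N : ℤ) ∣ n) : ∑ g, ch N n g = 0 := by
  have hN' : (N : ℂ) ≠ 0 := by exact_mod_cast hN.ne'
  have hpc : (π : ℂ) ≠ 0 := by exact_mod_cast Real.pi_pos.ne'
  set ζ : ℂ := Complex.exp (-n / N * (2 * π * Complex.I)) with hζ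
  have e : ∀ g : Fin N, ch N n g = ζ ^ (g : ℕ) := by
    intro g
    rw [ch, gp, fourier_coe_apply, hζ, ← Complex.exp_nat_mul]
    congr 1
    push_cast
    field_simp
  simp only [e]
  rw [Fin.sum_univ_eq_sum_range (fun i => ζ ^ i)]
  have h1 : ζ ≠ 1 := by
    intro h
    obtain ⟨k, hk⟩ := Complex.exp_eq_one_iff.1 h
    have h2 : (2 * π * Complex.I : ℂ) ≠ 0 := by simp [hpc]
    have h3 := mul_right_cancel₀ h2 hk
    rw [div_eq_iff hN'] at h3
    apply hn
    refine ⟨-k, ?_⟩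
    have : (-n : ℤ) = k * N := by exact_mod_cast h3
    linarith
  have h2 : ζ ^ N = 1 := by
    rw [hζ, ← Complex.exp_nat_mul, Complex.exp_eq_one_iff]
    refine ⟨-n, ?_⟩
    push_cast
    field_simp
  rw [geom_sum_eq h1, h2]
  simp

/-- The random coefficients. -/
def bb (N M : ℕ) (x : Fin M → Fin N) (n : ℤ) : ℂ :=
  tri (2 * π / N) n * ((M : ℂ)⁻¹ * ∑ j, ch N n (x j))

lemma avg_norm_le {N M : ℕ} (hM : 0 < M) (x : Fin M → Fin N) (n : ℤ) :
    ‖(M : ℂ)⁻¹ * ∑ j, ch N n (x j)‖ ≤ 1 := by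
  have hM' : (0 : ℝ) < M := by exact_mod_cast hM
  rw [norm_mul, norm_inv, Complex.norm_natCast, inv_mul_le_iff₀ hM']
  refine (norm_sum_le _ _).trans ?_
  simp [ch_norm]

lemma bb_zero {N M : ℕ} (hM : 0 < M) (x : Fin M → Fin N) : bb N M x 0 = 1 := by
  have hM' : (M : ℂ) ≠ 0 := by exact_mod_cast hM.ne'
  simp [bb, tri, ch, hM']

lemma bb_norm_le {N M : ℕ} (hM : 0 < M) (x : Fin M → Fin N) (n : ℤ) :
    ‖bb N M x n‖ ≤ tri (2 * π / N) n := by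
  rw [bb, norm_mul, Complex.norm_real, Real.norm_of_nonneg (tri_nonneg _ _)]
  exact mul_le_of_le_one_right (tri_nonneg _ _) (avg_norm_le hM x n)

lemma S1_tri {β : ℝ} (hβ : 0 ≤ β) (hβ1 : β < 1) {N : ℕ} (hN : 0 < N) :
    Summable fun n => tri (2 * π / N) n * wt β n := by
  have h1 : Summable fun n : ℤ => |(n : ℝ)| ^ (-(2 - β)) := Real.summable_abs_int_rpow (by linarith)
  have h2 : Summable fun n : ℤ => if n = 0 then (1 : ℝ) else 0 := (hasSum_ite_eq 0 1).summable
  refine Summable.of_nonneg_of_le (fun n => mul_nonneg (tri_nonneg _ _) (wt_pos _ _).le)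
    (fun n => ?_) ((h1.mul_left ((N : ℝ) ^ 2 * 2 ^ β)).add h2)
  by_cases hn : n = 0
  · subst hn
    simp only [tri, if_true, wt_zero]
    have : 0 ≤ (N : ℝ) ^ 2 * 2 ^ β * |((0 : ℤ) : ℝ)| ^ (-(2 - β)) := by positivity
    linarith
  · rw [if_neg hn, add_zero]
    have hn0 : (n : ℝ) ≠ 0 := by exact_mod_cast hn
    have hp : 0 < |(n : ℝ)| := abs_pos.2 hn0
    have h1n : 1 ≤ |(n : ℝ)| := by exact_mod_cast Int.one_le_abs hn
    have hw : wt β n ≤ 2 ^ β * |(n : ℝ)| ^ β := by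
      rw [wt, ← Real.mul_rpow (by norm_num) hp.le]
      exact Real.rpow_le_rpow (by positivity) (by linarith) hβ
    calc _ ≤ (N ^ 2 / (n : ℝ) ^ 2) * (2 ^ β * |(n : ℝ)| ^ β) :=
          mul_le_mul (tri_le_inv hN hn) hw (wt_pos _ _).le (by positivity)
      _ = _ := by
          rw [show -(2 - β) = β - 2 by ring, Real.rpow_sub hp, Real.rpow_two, sq_abs]; ring

lemma S1_bb {β : ℝ} (hβ : 0 ≤ β) (hβ1 : β < 1) {N M : ℕ} (hN : 0 < N) (hM : 0 < M)
    (x : Fin M → Fin N) : S1 β (bb N M x) :=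
  Summable.of_nonneg_of_le (fun n => mul_nonneg (norm_nonneg _) (wt_pos _ _).le)
    (fun n => mul_le_mul_of_nonneg_right (bb_norm_le hM x n) (wt_pos _ _).le) (S1_tri hβ hβ1 hN)

lemma fourier_sub_point (n : ℤ) (y z : AddCircle (2 * π)) :
    (fourier n (y - z) : ℂ) = fourier n y * fourier (-n) z := by
  rw [fourier_apply, fourier_apply, fourier_apply, smul_sub, sub_eq_add_neg, ← neg_smul,
    AddCircle.toCircle_add]
  rfl

lemma fSum_bb {N M : ℕ} (hN : 0 < N) (x : Fin M → Fin N) (y : AddCircle (2 * π)) :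
    fSum (bb N M x) y =
      (M : ℂ)⁻¹ * ∑ j, fSum (fun n => (tri (2 * π / N) n : ℂ)) (y - gp N (x j)) := by
  have hs : Summable fun n => ‖(tri (2 * π / N) n : ℂ)‖ := by
    have := S1_tri (β := 0) le_rfl zero_lt_one hN
    refine this.congr fun n => ?_
    rw [Complex.norm_real, Real.norm_of_nonneg (tri_nonneg _ _)]
    simp [wt]
  unfold fSum
  rw [← Summable.tsum_finsetSum (fun j _ => summable_fourier hs _), ← tsum_mul_left]
  apply tsum_congr
  intro n
  rw [bb, Finset.mul_sum, Finset.mul_sum, Finset.sum_mul, Finset.mul_sum]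
  apply Finset.sum_congr rfl
  intro j _
  rw [fourier_sub_point, ch]
  ring

lemma fSum_bb_nonneg {N M : ℕ} (hN : 2 ≤ N) (x : Fin M → Fin N) (y : AddCircle (2 * π)) :
    ∃ r : ℝ, 0 ≤ r ∧ fSum (bb N M x) y = r := by
  have hpi := Real.pi_pos
  have hN0 : (0 : ℝ) < N := by exact_mod_cast (by omega : 0 < N)
  have hN2 : (2 : ℝ) ≤ N := by exact_mod_cast hN
  have ha' : 2 * π / N ≤ π := by rw [div_le_iff₀ hN0]; nlinarith
  choose r hr0 hr using fun j => fSum_tri_nonneg (a := 2 * π / N) (by positivity) ha' (y - gp N (x j))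
  refine ⟨(M : ℝ)⁻¹ * ∑ j, r j, mul_nonneg (by positivity) (Finset.sum_nonneg fun j _ => hr0 j), ?_⟩
  rw [fSum_bb (by omega)]
  simp only [hr]
  push_cast
  rfl

lemma fSum_bb_supp {N M : ℕ} (hN : 2 ≤ N) (x : Fin M → Fin N) (y : AddCircle (2 * π))
    (h : fSum (bb N M x) y ≠ 0) : ∃ j, y ∈ Metric.closedBall (gp N (x j)) (2 * π / N) := by
  have hpi := Real.pi_pos
  have hN0 : (0 : ℝ) < N := by exact_mod_cast (by omega : 0 < N)
  have hN2 : (2 : ℝ) ≤ N := by exact_mod_cast hN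
  have ha' : 2 * π / N ≤ π := by rw [div_le_iff₀ hN0]; nlinarith
  by_contra! hc
  apply h
  rw [fSum_bb (by omega), Finset.sum_eq_zero, mul_zero]
  intro j _
  apply fSum_tri_eq_zero (by positivity) ha'
  have := hc j
  rw [Metric.mem_closedBall, not_le, dist_eq_norm] at this
  exact this.le

lemma exists_good {β q : ℝ} (hβ : 0 ≤ β) (hq : 2 < q) (hβq : β * q < 1) {N M : ℕ} (hN : 2 ≤ N)
    (hM : 4 ≤ M) : ∃ x : Fin M → Fin N,
      (Summable fun n => (‖bb N M x n - dl n‖ / wt β n) ^ q) ∧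
      ∑' n, (‖bb N M x n - dl n‖ / wt β n) ^ q ≤
        2 * Real.exp 4 * q ^ q * (M : ℝ) ^ (-(q / 2)) *
          (2 * (1 / (1 - β * q) + 1) * (N : ℝ) ^ (1 - β * q)) := by
  have hpi := Real.pi_pos
  have hN0 : (0 : ℝ) < N := by exact_mod_cast (by omega : 0 < N)
  haveI : Nonempty (Fin N) := ⟨⟨0, by omega⟩⟩
  obtain ⟨hv, hvle⟩ := vv_sum (s := β * q) (by positivity) hβq (N := N) (by omega)
  -- pointwise bound
  have pt : ∀ (x : Fin M → Fin N) n, (‖bb N M x n - dl n‖ / wt β n) ^ q ≤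
      vv (β * q) N n * ‖(M : ℂ)⁻¹ * ∑ j, ch N n (x j)‖ ^ q := by
    intro x n
    by_cases hn : n = 0
    · subst hn
      rw [bb_zero (by omega)]
      simp [dl, vv, Real.zero_rpow (by linarith : q ≠ 0)]
    · have hw : wt β n ^ q = (1 + |(n : ℝ)|) ^ (β * q) := by
        rw [wt, ← Real.rpow_mul (by positivity)]
      have ht := tri_nonneg (2 * π / N) n
      have ht1 := tri_le_one (a := 2 * π / N) (by positivity) n
      simp only [dl, hn, if_false, sub_zero, vv]
      rw [bb, norm_mul, Complex.norm_real, Real.norm_of_nonneg ht,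
        Real.div_rpow (by positivity) (wt_pos _ _).le, Real.mul_rpow ht (norm_nonneg _), hw,
        Real.rpow_neg (by positivity), div_eq_mul_inv]
      have : tri (2 * π / N) n ^ q ≤ tri (2 * π / N) n := by
        calc _ ≤ tri (2 * π / N) n ^ (1 : ℝ) :=
              Real.rpow_le_rpow_of_exponent_ge' ht ht1 zero_le_one (by linarith)
          _ = _ := Real.rpow_one _
      rw [mul_right_comm]
      gcongr
  have hnn : ∀ (x : Fin M → Fin N) n, 0 ≤ (‖bb N M x n - dl n‖ / wt β n) ^ q := fun x n =>
    Real.rpow_nonneg (div_nonneg (norm_nonneg _) (wt_pos _ _).le) _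
  have hs : ∀ x : Fin M → Fin N, Summable fun n => (‖bb N M x n - dl n‖ / wt β n) ^ q := by
    intro x
    refine Summable.of_nonneg_of_le (hnn x) (fun n => (pt x n).trans ?_) hv
    exact mul_le_of_le_one_right (vv_nonneg _ _ _)
      (Real.rpow_le_one (norm_nonneg _) (avg_norm_le (by omega) x n) (by linarith))
  set A := 2 * Real.exp 4 * q ^ q * (M : ℝ) ^ (-(q / 2)) with hA
  have hA0 : 0 ≤ A := by positivity
  have hsum : ∀ n, ∑ x : Fin M → Fin N, (‖bb N M x n - dl n‖ / wt β n) ^ q ≤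
      vv (β * q) N n * ((N : ℝ) ^ M * A) := by
    intro n
    refine (Finset.sum_le_sum fun x _ => pt x n).trans ?_
    rw [← Finset.mul_sum]
    by_cases hd : (N : ℤ) ∣ n
    · have : vv (β * q) N n = 0 := by
        unfold vv
        split_ifs with h
        · rfl
        · rw [tri_dvd (by omega) h hd, zero_mul]
      simp [this]
    · apply mul_le_mul_of_nonneg_left _ (vv_nonneg _ _ _)
      have := moment_bound (ch N n) (ch_sum (by omega) hd) (ch_norm N n) (q := q) (by linarith) hM
      simpa using this
  have htot : ∑ x : Fin M → Fin N, ∑' n, (‖bb N M x n - dl n‖ / wt β n) ^ q ≤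
      ∑ x : Fin M → Fin N, A * (2 * (1 / (1 - β * q) + 1) * (N : ℝ) ^ (1 - β * q)) := by
    rw [← Summable.tsum_finsetSum (fun x _ => hs x)]
    calc _ ≤ ∑' n, vv (β * q) N n * ((N : ℝ) ^ M * A) :=
          Summable.tsum_le_tsum hsum (summable_sum fun x _ => hs x) (hv.mul_right _)
      _ = (∑' n, vv (β * q) N n) * ((N : ℝ) ^ M * A) := tsum_mul_right
      _ ≤ (2 * (1 / (1 - β * q) + 1) * (N : ℝ) ^ (1 - β * q)) * ((N : ℝ) ^ M * A) := by
          gcongr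
      _ = _ := by
          simp
          ring
  obtain ⟨x, -, hx⟩ := Finset.exists_le_of_sum_le Finset.univ_nonempty htot
  exact ⟨x, hs x, hx⟩

/-! ### Choice of parameters -/

lemma tendsto_const_mul_log_rpow (A : ℝ) {c : ℝ} (hc : 0 < c) :
    Tendsto (fun N : ℕ => A * (Real.log N) ^ (-c)) atTop (𝓝 0) := by
  have := ((tendsto_rpow_neg_atTop hc).comp
    (Real.tendsto_log_atTop.comp tendsto_natCast_atTop_atTop)).const_mul A
  simpa using this

lemma exists_params {α γ q s A ε : ℝ} (hα : 0 < α) (hγ : 0 < γ) (hq : 2 < q)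
    (hrel : α * q / 2 = 1 - s) (hA : 0 ≤ A) (hε : 0 < ε) :
    ∃ N M : ℕ, 2 ≤ N ∧ 4 ≤ M ∧ A * ((M : ℝ) ^ (-(q / 2)) * (N : ℝ) ^ (1 - s)) ≤ ε ^ q ∧
      4 * π / N ≤ ε ∧ 4 * π / N ≤ 1 ∧
      M * ((4 * π / N) ^ α / (Real.log (Real.exp 1 / (4 * π / N))) ^ γ) ≤ ε := by
  have hpi := Real.pi_gt_three
  have E1 := (tendsto_const_mul_log_rpow A (c := γ * q / 4) (by positivity)).eventually_le_const
    (show 0 < ε ^ q by positivity)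
  have E2 := (tendsto_const_mul_log_rpow (6 * (4 * π) ^ α * 2 ^ γ) (c := γ / 2)
    (by positivity)).eventually_le_const hε
  have E3 : Tendsto (fun N : ℕ => 4 * π / (N : ℝ)) atTop (𝓝 0) := by
    exact tendsto_const_div_atTop_nhds_zero_nat _
  have E3a := E3.eventually_le_const hε
  have E3b := E3.eventually_le_const zero_lt_one
  have E4 := (Real.tendsto_log_atTop.comp tendsto_natCast_atTop_atTop).eventually_ge_atTop
    (2 * Real.log (4 * π) + 1)
  obtain ⟨N, h1, h2, h3, h3', h4, h5⟩ :=
    (E1.and (E2.and (E3a.and (E3b.and (E4.and (eventually_ge_atTop 3)))))).exists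
  simp only [Function.comp] at h4
  have hN0 : (0 : ℝ) < N := by exact_mod_cast (by omega : 0 < N)
  have hN1 : (1 : ℝ) ≤ N := by exact_mod_cast (by omega : 1 ≤ N)
  have hl4 : 0 ≤ Real.log (4 * π) := Real.log_nonneg (by linarith)
  set L := Real.log N with hL
  have hL1 : 1 ≤ L := by linarith
  have hL0 : 0 < L := by linarith
  set Y := (N : ℝ) ^ α * L ^ (γ / 2) with hY
  have hY1 : 1 ≤ Y := one_le_mul_of_one_le_of_one_le (Real.one_le_rpow hN1 hα.le)
    (Real.one_le_rpow hL1 (by positivity))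
  have hY0 : 0 < Y := by linarith
  refine ⟨N, ⌈Y⌉₊ + 4, by omega, by omega, ?_, h3, h3', ?_⟩
  · refine le_trans (mul_le_mul_of_nonneg_left ?_ hA) h1
    have hM : Y ≤ ((⌈Y⌉₊ + 4 : ℕ) : ℝ) := by
      push_cast; linarith [Nat.le_ceil Y]
    calc _ ≤ Y ^ (-(q / 2)) * (N : ℝ) ^ (1 - s) := by
          exact mul_le_mul_of_nonneg_right (Real.rpow_le_rpow_of_nonpos hY0 hM
            (by linarith : -(q / 2) ≤ 0)) (by positivity)
      _ = _ := by
          rw [hY, Real.mul_rpow (by positivity) (by positivity), ← Real.rpow_mul hN0.le,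
            ← Real.rpow_mul hL0.le, mul_right_comm, ← Real.rpow_add hN0,
            show α * -(q / 2) + (1 - s) = 0 by linarith, Real.rpow_zero, one_mul]
          congr 1; ring
  · have hM : ((⌈Y⌉₊ + 4 : ℕ) : ℝ) ≤ 6 * Y := by
      push_cast; linarith [Nat.ceil_lt_add_one hY0.le]
    have hlog : L / 2 ≤ Real.log (Real.exp 1 / (4 * π / N)) := by
      rw [Real.log_div (Real.exp_pos 1).ne' (by positivity), Real.log_exp,
        Real.log_div (by positivity) hN0.ne', ← hL]
      linarith
    calc _ ≤ (6 * Y) * ((4 * π / N) ^ α / (L / 2) ^ γ) := by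
          gcongr
          exact div_nonneg (by positivity) (Real.rpow_nonneg (by linarith) _)
      _ = 6 * (4 * π) ^ α * 2 ^ γ * L ^ (-(γ / 2)) := by
          have hh : L ^ γ = L ^ (γ / 2) * L ^ (γ / 2) := by
            rw [← Real.rpow_add hL0]; congr 1; ring
          rw [hY, Real.div_rpow (by positivity) hN0.le, Real.div_rpow hL0.le (by norm_num),
            Real.rpow_neg hL0.le, hh]
          field_simp
      _ ≤ ε := h2

/-- The gauge. -/
def gaugeFn (α γ : ℝ) (r : ℝ≥0∞) : ℝ≥0∞ :=
  ENNReal.ofReal (r.toReal ^ α / (Real.log (Real.exp 1 / r.toReal)) ^ γ)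

lemma gaugeFn_le {α γ : ℝ} (hα : 0 < α) (hγ : 0 < γ) {r : ℝ≥0∞} {D : ℝ} (hD : 0 < D) (hD1 : D ≤ 1)
    (hr : r ≤ ENNReal.ofReal D) :
    gaugeFn α γ r ≤ ENNReal.ofReal (D ^ α / (Real.log (Real.exp 1 / D)) ^ γ) := by
  unfold gaugeFn
  have hrD : r.toReal ≤ D := ENNReal.toReal_le_of_le_ofReal hD.le hr
  have hr0 : 0 ≤ r.toReal := ENNReal.toReal_nonneg
  rcases hr0.eq_or_lt with h | h
  · rw [← h, Real.zero_rpow hα.ne', zero_div, ENNReal.ofReal_zero]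
    exact zero_le
  · apply ENNReal.ofReal_le_ofReal
    have h1 : 0 < Real.log (Real.exp 1 / D) := by
      rw [Real.log_div (Real.exp_pos 1).ne' hD.ne', Real.log_exp]
      linarith [Real.log_nonpos hD.le hD1]
    have h2 : Real.log (Real.exp 1 / D) ≤ Real.log (Real.exp 1 / r.toReal) := by
      apply Real.log_le_log (by positivity)
      gcongr
    gcongr

lemma exists_block {p q β α γ : ℝ} (hpq : p.HolderConjugate q) (hβ : 0 ≤ β) (hq : 2 < q)
    (hβq : β * q < 1) (hα : 0 < α) (hrel : α * q / 2 = 1 - β * q) (hγ : 0 < γ) (ε : ℝ)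
    (hε : 0 < ε) :
    ∃ b : ℤ → ℂ, S1 β b ∧ (∀ y, ∃ r : ℝ, 0 ≤ r ∧ fSum b y = r) ∧
      Bd p β (fun n => b n - dl n) ε ∧
      ∃ (M : ℕ) (z : Fin M → AddCircle (2 * π)) (a : ℝ),
        (∀ y, fSum b y ≠ 0 → ∃ j, y ∈ Metric.closedBall (z j) a) ∧
        (∀ j, Metric.ediam (Metric.closedBall (z j) a) ≤ ENNReal.ofReal ε) ∧
        ∑ j, gaugeFn α γ (Metric.ediam (Metric.closedBall (z j) a)) ≤ ENNReal.ofReal ε := by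
  have hpi := Real.pi_pos
  have hs1 : 0 < 1 - β * q := by linarith
  obtain ⟨N, M, hN, hM, hle, hD, hD1, hg⟩ := exists_params (s := β * q) hα hγ hq hrel
    (A := 2 * Real.exp 4 * q ^ q * (2 * (1 / (1 - β * q) + 1)))
    (by positivity) hε
  have hN0 : (0 : ℝ) < N := by exact_mod_cast (by omega : 0 < N)
  obtain ⟨x, hxs, hxle⟩ := exists_good hβ hq hβq hN hM
  have hβ1 : β < 1 := by nlinarith
  have hdiam : ∀ j : Fin M, Metric.ediam (Metric.closedBall (gp N (x j)) (2 * π / N)) ≤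
      ENNReal.ofReal (4 * π / N) := by
    intro j
    apply Metric.ediam_le
    intro u hu v hv
    rw [edist_dist]
    apply ENNReal.ofReal_le_ofReal
    have := dist_triangle_right u v (gp N (x j))
    rw [Metric.mem_closedBall] at hu hv
    calc _ ≤ _ := this
      _ ≤ 2 * π / N + 2 * π / N := add_le_add hu hv
      _ = _ := by ring
  refine ⟨bb N M x, S1_bb hβ hβ1 (by omega) (by omega) x, fSum_bb_nonneg hN x,
    Bd.of_lq hpq hε.le hxs (hxle.trans (le_trans (le_of_eq (by ring)) hle)), M, fun j => gp N (x j),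
    2 * π / N, fSum_bb_supp hN x, fun j => (hdiam j).trans (ENNReal.ofReal_le_ofReal hD), ?_⟩
  calc _ ≤ ∑ j : Fin M, ENNReal.ofReal
        ((4 * π / N) ^ α / (Real.log (Real.exp 1 / (4 * π / N))) ^ γ) :=
        Finset.sum_le_sum fun j _ => gaugeFn_le hα hγ (by positivity) hD1 (hdiam j)
    _ = ENNReal.ofReal (M * ((4 * π / N) ^ α / (Real.log (Real.exp 1 / (4 * π / N))) ^ γ)) := by
        rw [ENNReal.ofReal_mul (by positivity)]
        simp
    _ ≤ _ := ENNReal.ofReal_le_ofReal hg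

/-! ### The construction -/

lemma pairing_small {β δ : ℝ} (hβ : 0 ≤ β) {F H : ℤ → ℂ} (hF : S1 β F) (hH : S1 β H)
    (hpos : ∀ y, ∃ r : ℝ, 0 ≤ r ∧ fSum F y = r) (hδ : ∀ y, fSum F y ≠ 0 → ‖fSum H y‖ ≤ δ) :
    ‖convSeq F H 0‖ ≤ δ * ‖F 0‖ := by
  have hFs := hF.summable_norm hβ
  have hHs := hH.summable_norm hβ
  rw [coeff_zero_eq ((hF.conv hβ hH).summable_norm hβ)]
  have hF0 : ‖F 0‖ = ∫ t, ‖fSum F t‖ ∂(AddCircle.haarAddCircle (T := 2 * Real.pi)) := by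
    rw [coeff_zero_eq hFs]
    choose r hr0 hr using hpos
    simp only [hr, Complex.norm_real, Real.norm_of_nonneg (hr0 _)]
    rw [integral_complex_ofReal, Complex.norm_real, Real.norm_of_nonneg (integral_nonneg hr0)]
  rw [hF0, ← integral_const_mul]
  refine norm_integral_le_of_norm_le ?_ (Filter.Eventually.of_forall fun t => ?_)
  · apply Integrable.const_mul
    exact Continuous.integrable_of_hasCompactSupport (fSum_continuous hFs).norm
      (HasCompactSupport.of_compactSpace _)
  · rw [fSum_conv hFs hHs, norm_mul]
    by_cases h : fSum F t = 0
    · simp [h]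
    · rw [mul_comm]
      exact mul_le_mul_of_nonneg_right (hδ t h) (norm_nonneg _)

lemma exists_seq {p q β α γ : ℝ} (hpq : p.HolderConjugate q) (hβ : 0 ≤ β) (hq : 2 < q)
    (hβq : β * q < 1) (hα : 0 < α) (hrel : α * q / 2 = 1 - β * q) (hγ : 0 < γ) :
    ∃ (F : ℕ → ℤ → ℂ) (T : ℕ → Set (AddCircle (2 * π))),
      F 0 = dl ∧ (∀ k, S1 β (F k)) ∧ (∀ k y, ∃ r : ℝ, 0 ≤ r ∧ fSum (F k) y = r) ∧
      (∀ k, IsClosed (T k)) ∧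
      (∀ k y, fSum (F k) y ≠ 0 → ∀ i < k, y ∈ T i) ∧
      (∀ k, Bd p β (fun n => F (k + 1) n - F k n) ((1 / 2) ^ (k + 2))) ∧
      Measure.mkMetric (gaugeFn α γ) (⋂ k, T k) = 0 := by
  have hp1 : 1 ≤ p := hpq.lt.le
  choose b hb1 hb2 hb3 M z a hb4 hb5 hb6 using
    exists_block hpq hβ hq hβq hα hrel hγ
  have hεpos : ∀ (k : ℕ) (G : ℤ → ℂ), 0 < (1 / 2 : ℝ) ^ (k + 2) / (nrm β G + 1) := by
    intro k G
    have := nrm_nonneg β G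
    positivity
  have hεle : ∀ (k : ℕ) (G : ℤ → ℂ), (1 / 2 : ℝ) ^ (k + 2) / (nrm β G + 1) ≤ (1 / 2) ^ k := by
    intro k G
    have := nrm_nonneg β G
    calc _ ≤ (1 / 2 : ℝ) ^ (k + 2) := div_le_self (by positivity) (by linarith)
      _ ≤ _ := pow_le_pow_of_le_one (by norm_num) (by norm_num) (by omega)
  let F : ℕ → ℤ → ℂ := fun k => Nat.rec dl (fun k G => convSeq G (b _ (hεpos k G))) k
  have hF0 : F 0 = dl := rfl
  have hFs : ∀ k, F (k + 1) = convSeq (F k) (b _ (hεpos k (F k))) := fun k => rfl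
  let T : ℕ → Set (AddCircle (2 * π)) := fun k =>
    ⋃ j, Metric.closedBall (z _ (hεpos k (F k)) j) (a _ (hεpos k (F k)))
  have hS : ∀ k, S1 β (F k) := by
    intro k
    induction k with
    | zero => exact S1_dl β
    | succ k ih => rw [hFs]; exact ih.conv hβ (hb1 _ _)
  have hmul : ∀ k y, fSum (F (k + 1)) y = fSum (F k) y * fSum (b _ (hεpos k (F k))) y := by
    intro k y
    rw [hFs, fSum_conv ((hS k).summable_norm hβ) ((hb1 _ _).summable_norm hβ)]
  refine ⟨F, T, hF0, hS, ?_, ?_, ?_, ?_, ?_⟩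
  · intro k
    induction k with
    | zero => intro y; exact ⟨1, zero_le_one, by rw [hF0, fSum_dl]; simp⟩
    | succ k ih =>
      intro y
      obtain ⟨r, hr0, hr⟩ := ih y
      obtain ⟨r', hr0', hr'⟩ := hb2 _ (hεpos k (F k)) y
      exact ⟨r * r', mul_nonneg hr0 hr0', by rw [hmul, hr, hr']; push_cast; rfl⟩
  · intro k
    exact isClosed_iUnion_of_finite fun j => Metric.isClosed_closedBall
  · intro k
    induction k with
    | zero => intro y _ i hi; omega
    | succ k ih =>
      intro y hy i hi
      rw [hmul] at hy
      rcases Nat.lt_succ_iff_lt_or_eq.1 hi with h | h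
      · exact ih y (left_ne_zero_of_mul hy) i h
      · subst h
        obtain ⟨j, hj⟩ := hb4 _ (hεpos i (F i)) y (right_ne_zero_of_mul hy)
        exact Set.mem_iUnion.2 ⟨j, hj⟩
  · intro k
    have e : (fun n => F (k + 1) n - F k n) =
        convSeq (F k) (fun n => b _ (hεpos k (F k)) n - dl n) := by
      ext n
      rw [convSeq_sub_right ((hS k).summable_norm hβ) ((hb1 _ _).summable_norm hβ)
        ((S1_dl β).summable_norm hβ), convSeq_dl_right, hFs]
    rw [e]
    have H := Bd.conv hp1 hβ (hεpos k (F k)).le (hS k) ((hb1 _ _).sub (S1_dl β))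
      (hb3 _ (hεpos k (F k)))
    intro g hg
    refine (H g hg).trans (mul_le_mul_of_nonneg_right ?_ (normA_nonneg _ _ _))
    have h0 := nrm_nonneg β (F k)
    rw [div_mul_eq_mul_div, div_le_iff₀ (by positivity)]
    exact mul_le_mul_of_nonneg_left (by linarith) (by positivity)
  · have hlim : Tendsto (fun k : ℕ => ENNReal.ofReal ((1 / 2 : ℝ) ^ k)) atTop (𝓝 0) := by
      have := ENNReal.tendsto_ofReal
        (tendsto_pow_atTop_nhds_zero_of_lt_one (r := (1 / 2 : ℝ)) (by norm_num) (by norm_num))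
      simpa using this
    have H := Measure.mkMetric_le_liminf_sum (⋂ k, T k) (l := atTop)
      (fun k : ℕ => ENNReal.ofReal ((1 / 2 : ℝ) ^ k)) hlim
      (fun k (j : Fin (M _ (hεpos k (F k)))) =>
        Metric.closedBall (z _ (hεpos k (F k)) j) (a _ (hεpos k (F k))))
      (Filter.Eventually.of_forall fun k j =>
        (hb5 _ (hεpos k (F k)) j).trans (ENNReal.ofReal_le_ofReal (hεle k (F k))))
      (Filter.Eventually.of_forall fun k => Set.iInter_subset T k) (gaugeFn α γ)
    refine le_antisymm (H.trans ?_) zero_le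
    rw [← hlim.liminf_eq]
    exact liminf_le_liminf (Filter.Eventually.of_forall fun k =>
      (hb6 _ (hεpos k (F k))).trans (ENNReal.ofReal_le_ofReal (hεle k (F k))))

lemma not_cyclic {p β : ℝ} (hp1 : 1 ≤ p) (hβ : 0 ≤ β) {F : ℕ → ℤ → ℂ}
    {T : ℕ → Set (AddCircle (2 * π))} (hF0 : F 0 = dl) (hS : ∀ k, S1 β (F k))
    (hpos : ∀ k y, ∃ r : ℝ, 0 ≤ r ∧ fSum (F k) y = r) (hT : ∀ k, IsClosed (T k))
    (hsupp : ∀ k y, fSum (F k) y ≠ 0 → ∀ i < k, y ∈ T i)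
    (hbd : ∀ k, Bd p β (fun n => F (k + 1) n - F k n) ((1 / 2) ^ (k + 2)))
    {c : ℤ → ℂ} (hc : S1 β c) (hz : ∀ y ∈ ⋂ k, T k, fSum c y = 0) : ¬ IsCyclicA p β c := by
  intro hcyc
  obtain ⟨A, hA, hnorm⟩ := hcyc (1 / 8) (by norm_num)
  have hAS : S1 β A := S1.of_finite hA
  have hH : S1 β (convSeq A c) := hAS.conv hβ hc
  have hHs := hH.summable_norm hβ
  set H := convSeq A c with hHdef
  have hG : S1 β (fun n => dl n - H n) := (S1_dl β).sub hH
  change normA p β (fun n => dl n - H n) < 1 / 8 at hnorm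
  -- bounds
  have key : ∀ k g, S1 β g → ‖convSeq (F k) g 0 - g 0‖ ≤ (1 / 2 - (1 / 2) ^ (k + 1)) * normA p β g := by
    intro k g hg
    induction k with
    | zero => rw [hF0, convSeq_dl_left]; simp
    | succ k ih =>
      have h1 := hbd k g hg
      rw [convSeq_sub_left ((hS _).summable_norm hβ) ((hS _).summable_norm hβ)
        (hg.summable_norm hβ)] at h1
      have h2 := norm_add_le (convSeq (F (k + 1)) g 0 - convSeq (F k) g 0) (convSeq (F k) g 0 - g 0)
      rw [sub_add_sub_cancel] at h2
      refine h2.trans ((add_le_add h1 ih).trans (le_of_eq ?_))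
      rw [pow_succ, pow_succ]; ring
  have key2 : ∀ k g, S1 β g → ‖convSeq (F k) g 0 - g 0‖ ≤ (1 / 2) * normA p β g := by
    intro k g hg
    refine (key k g hg).trans (mul_le_mul_of_nonneg_right ?_ (normA_nonneg _ _ _))
    have : (0 : ℝ) ≤ (1 / 2) ^ (k + 1) := by positivity
    linarith
  -- compactness
  obtain ⟨K, hK⟩ : ∃ K, ∀ y, (∀ i < K, y ∈ T i) → ‖fSum H y‖ ≤ 1 / 4 := by
    have hcl : IsCompact {y | 1 / 4 ≤ ‖fSum H y‖} :=
      (isClosed_le continuous_const (fSum_continuous hHs).norm).isCompact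
    obtain ⟨u, hu⟩ := hcl.elim_finite_subfamily_closed T hT (by
      ext y
      simp only [Set.mem_inter_iff, Set.mem_setOf_eq, Set.mem_empty_iff_false, iff_false, not_and]
      intro hy hy2
      rw [hHdef, fSum_conv (hAS.summable_norm hβ) (hc.summable_norm hβ), hz y hy2] at hy
      norm_num at hy)
    refine ⟨u.sup id + 1, fun y hy => ?_⟩
    by_contra! hlt
    have : y ∈ {y | 1 / 4 ≤ ‖fSum H y‖} ∩ ⋂ i ∈ u, T i := by
      refine ⟨hlt.le, ?_⟩
      simp only [Set.mem_iInter]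
      intro i hi
      exact hy i (Nat.lt_succ_of_le (Finset.le_sup (f := id) hi))
    rw [hu] at this
    exact this
  have hsmall := pairing_small hβ (hS K) hH (hpos K) (fun y hy => hK y (hsupp K y hy))
  have h0 := key2 K dl (S1_dl β)
  rw [convSeq_dl_right, normA_dl hp1] at h0
  have h1 := key2 K _ hG
  have h2 := norm_zero_le_normA hp1 hG
  rw [convSeq_sub_right ((hS K).summable_norm hβ) ((S1_dl β).summable_norm hβ) hHs,
    convSeq_dl_right] at h1
  have hd0 : dl 0 = 1 := by simp [dl]
  rw [hd0] at h0
  have t1 : ‖F K 0 - convSeq (F K) H 0‖ ≤ 3 / 16 := by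
    have := norm_add_le (F K 0 - convSeq (F K) H 0 - (dl 0 - H 0)) (dl 0 - H 0)
    rw [sub_add_cancel] at this
    linarith
  have t2 : ‖F K 0‖ ≤ ‖F K 0 - convSeq (F K) H 0‖ + ‖convSeq (F K) H 0‖ := by
    have := norm_add_le (F K 0 - convSeq (F K) H 0) (convSeq (F K) H 0)
    rwa [sub_add_cancel] at this
  have t3 : 1 ≤ ‖F K 0 - 1‖ + ‖F K 0‖ := by
    have := norm_sub_le (F K 0) (F K 0 - 1)
    rw [_root_.sub_sub_cancel, norm_one] at this
    linarith
  linarith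

/-- Theorem B(2): let `1 < p < 2`, `β ≥ 0`, `βq < 1` where
`q = p/(p-1)`, and `α = (2/q)(1-βq)`. For every `γ > 2/q` there is a closed set
`E ⊆ 𝕋` with Hausdorff `h`-measure zero, where `h(t) = t^α / (ln(e/t))^γ`, such
that every `f ∈ A^1_β(𝕋)` with `Z(f) = E` is not cyclic in `A^p_β(𝕋)`. -/
theorem stmt5 (p q β α : ℝ) (hp1 : 1 < p) (hp2 : p < 2) (hβ : 0 ≤ β)
    (hq : q = p / (p - 1)) (hβq : β * q < 1) (hα : α = (2 / q) * (1 - β * q))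
    (γ : ℝ) (hγ : 2 / q < γ) :
    ∃ E : Set (AddCircle (2 * Real.pi)), IsClosed E ∧
      Measure.mkMetric
        (fun r : ℝ≥0∞ =>
          ENNReal.ofReal (r.toReal ^ α / (Real.log (Real.exp 1 / r.toReal)) ^ γ)) E = 0 ∧
      ∀ c : ℤ → ℂ, MemA 1 β c → zeroSet c = E → ¬ IsCyclicA p β c := by
  have hp0 : 0 < p - 1 := by linarith
  have hpq : p.HolderConjugate q := (Real.holderConjugate_iff_eq_conjExponent hp1).2 hq
  have hq2 : 2 < q := by
    rw [hq, lt_div_iff₀ hp0]; linarith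
  have hq0 : 0 < q := by linarith
  have hα0 : 0 < α := by
    rw [hα]; exact mul_pos (by positivity) (by linarith)
  have hrel : α * q / 2 = 1 - β * q := by
    rw [hα]; field_simp
  have hγ0 : 0 < γ := lt_trans (by positivity) hγ
  obtain ⟨F, T, hF0, hS, hpos, hT, hsupp, hbd, hmeas⟩ :=
    exists_seq hpq hβ hq2 hβq hα0 hrel hγ0
  refine ⟨⋂ k, T k, isClosed_iInter hT, hmeas, fun c hc hz => ?_⟩
  refine not_cyclic hp1.le hβ hF0 hS hpos hT hsupp hbd ((memA_one_iff β c).1 hc) (fun y hy => ?_)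
  rw [← hz] at hy
  exact hy

end
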